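/- Let Ω ⊂ ℝⁿ be a smooth bounded open set and Ω_δ = T_δ(Ω), where T_δ(x) = (1 − δΛ)x + R(x,δ) are C¹-diffeomorphisms with R(x,δ) = o(δ) and D_xR(x,δ) = o(δ) uniformly in x. Then h(Ω_δ) → h(Ω) as δ → 0, and δ ↦ h(Ω_δ) is differentiable at 0 with derivative Λ·h(Ω). -/

import Mathlib

open MeasureTheory Metric Filter Set Topology Asymptotics Bornology
open scoped ENNReal NNReal

noncomputable section

abbrev Euc (n : ℕ) := EuclideanSpace ℝ (Fin n)

/-- The measure-theoretic (essential) boundary of a set: points where the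
volume density of `D` neither tends to `0` nor to `1`. -/
def essBoundary {n : ℕ} (D : Set (Euc n)) : Set (Euc n) :=
  {x | ¬ Tendsto (fun r : ℝ => volume (D ∩ ball x r) / volume (ball x r))
        (𝓝[>] 0) (𝓝 0) ∧
       ¬ Tendsto (fun r : ℝ => volume (D ∩ ball x r) / volume (ball x r))
        (𝓝[>] 0) (𝓝 1)}

/-- The (De Giorgi) perimeter of a set, via Federer's theorem: the
`(n-1)`-dimensional Hausdorff measure of the essential boundary. -/
def perim (n : ℕ) (D : Set (Euc n)) : ℝ≥0∞ := μH[(n : ℝ) - 1] (essBoundary D)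

/-- The Cheeger constant of `Ω`: infimum of perimeter/volume over subsets of
finite perimeter and positive volume. -/
def cheeger (n : ℕ) (Ω : Set (Euc n)) : ℝ :=
  sInf {r : ℝ | ∃ D : Set (Euc n), D ⊆ Ω ∧ perim n D < ⊤ ∧ 0 < volume D ∧
        r = (perim n D).toReal / (volume D).toReal}

/-- A Cheeger set: an admissible set attaining the Cheeger constant. -/
def IsCheegerSet (n : ℕ) (Ω A : Set (Euc n)) : Prop :=
  A ⊆ Ω ∧ perim n A < ⊤ ∧ 0 < volume A ∧
    (perim n A).toReal / (volume A).toReal = cheeger n Ω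

/-- The 1-capacity of a set `K`: infimum of perimeters of bounded open sets
containing `K`. -/
def cap1 (n : ℕ) (K : Set (Euc n)) : ℝ :=
  sInf {r : ℝ | ∃ ω : Set (Euc n), IsOpen ω ∧ IsBounded ω ∧ K ⊆ ω ∧
        r = (perim n ω).toReal}

/-- The volume `b_n` of the unit ball of `ℝⁿ`. -/
def unitBallVol (n : ℕ) : ℝ := (volume (ball (0 : Euc n) 1)).toReal

/-- The property that `D` has (outer) volume density `c` at `x`. -/
def HasDensity {n : ℕ} (D : Set (Euc n)) (x : Euc n) (c : ℝ≥0∞) : Prop :=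
  Tendsto (fun r : ℝ => volume (D ∩ ball x r) / volume (ball x r)) (𝓝[>] 0) (𝓝 c)

lemma mem_essBoundary_iff {n : ℕ} {D : Set (Euc n)} {x : Euc n} :
    x ∈ essBoundary D ↔ ¬ HasDensity D x 0 ∧ ¬ HasDensity D x 1 := Iff.rfl

lemma LipschitzWith.volume_image_le {n : ℕ} {f : Euc n → Euc n} {K : ℝ≥0}
    (hf : LipschitzWith K f) (s : Set (Euc n)) :
    volume (f '' s) ≤ (K : ℝ≥0∞) ^ n * volume s := by
  have hfin : Module.finrank ℝ (Euc n) = n := by simp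
  have h := Measure.isAddLeftInvariant_eq_smul (volume : Measure (Euc n))
    (μH[Module.finrank ℝ (Euc n)] : Measure (Euc n))
  rw [h, Measure.smul_apply, Measure.smul_apply, ENNReal.smul_def, smul_eq_mul,
    ENNReal.smul_def, smul_eq_mul, mul_left_comm]
  gcongr
  have := hf.hausdorffMeasure_image_le (d := (Module.finrank ℝ (Euc n) : ℝ)) (by positivity) s
  rw [ENNReal.rpow_natCast] at this
  rwa [hfin] at this ⊢

lemma volume_ball_scale {n : ℕ} (x y : Euc n) {M r : ℝ} (hM : 0 < M) :
    volume (ball x (M * r)) = ENNReal.ofReal M ^ n * volume (ball y r) := by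
  rw [Measure.addHaar_ball_mul_of_pos _ x hM r, Measure.addHaar_ball_center _ y r,
    ENNReal.ofReal_pow hM.le]
  simp

lemma HasDensity.image_zero {n : ℕ} (e : Euc n ≃ Euc n) {L M : ℝ≥0} (hM : 0 < M)
    (hL : LipschitzWith L e) (hMe : LipschitzWith M e.symm) {D : Set (Euc n)} {x : Euc n}
    (h : HasDensity D x 0) : HasDensity (e '' D) (e x) 0 := by
  have hM' : (0 : ℝ) < M := hM
  have hscale : Tendsto (fun r : ℝ => (M : ℝ) * r) (𝓝[>] 0) (𝓝[>] 0) := by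
    refine tendsto_nhdsWithin_iff.2 ⟨?_, ?_⟩
    · have : Tendsto (fun r : ℝ => (M : ℝ) * r) (𝓝 0) (𝓝 ((M : ℝ) * 0)) :=
        (continuous_const.mul continuous_id).tendsto 0
      rw [mul_zero] at this
      exact this.mono_left nhdsWithin_le_nhds
    · filter_upwards [self_mem_nhdsWithin] with r hr
      exact mul_pos hM' hr
  have h1 := ENNReal.Tendsto.const_mul (a := (L : ℝ≥0∞) ^ n * (M : ℝ≥0∞) ^ n)
    (h.comp hscale) (Or.inr (by finiteness))
  rw [mul_zero] at h1
  refine tendsto_of_tendsto_of_tendsto_of_le_of_le' tendsto_const_nhds h1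
    (Eventually.of_forall fun _ => zero_le) ?_
  filter_upwards [self_mem_nhdsWithin] with r hr
  have hr : 0 < r := hr
  have hsub : e '' D ∩ ball (e x) r ⊆ e '' (D ∩ ball x (M * r)) := by
    rintro _ ⟨⟨z, hz, rfl⟩, hzr⟩
    refine ⟨z, ⟨hz, ?_⟩, rfl⟩
    have := hMe.dist_le_mul (e z) (e x)
    rw [e.symm_apply_apply, e.symm_apply_apply] at this
    exact this.trans_lt (mul_lt_mul_of_pos_left hzr hM')
  have hvol := (measure_mono hsub).trans (hL.volume_image_le (D ∩ ball x (M * r)))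
  have hball := volume_ball_scale x (e x) (r := r) hM'
  rw [ENNReal.ofReal_coe_nnreal] at hball
  have hMn : (M : ℝ≥0∞) ^ n ≠ 0 := pow_ne_zero _ (by exact_mod_cast hM.ne')
  have hMt : (M : ℝ≥0∞) ^ n ≠ ⊤ := by finiteness
  calc volume (e '' D ∩ ball (e x) r) / volume (ball (e x) r)
      ≤ ((L : ℝ≥0∞) ^ n * volume (D ∩ ball x (M * r))) / volume (ball (e x) r) := by gcongr
    _ = (L : ℝ≥0∞) ^ n * (M : ℝ≥0∞) ^ n *
        (volume (D ∩ ball x (M * r)) / volume (ball x (M * r))) := by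
        rw [hball, mul_assoc, ← mul_div_assoc ((M : ℝ≥0∞) ^ n), ENNReal.mul_div_mul_left _ _ hMn hMt,
          mul_div_assoc]

lemma hasDensity_toMeasurable {n : ℕ} {D : Set (Euc n)} {x : Euc n} {c : ℝ≥0∞} :
    HasDensity (toMeasurable volume D) x c ↔ HasDensity D x c := by
  simp only [HasDensity, Measure.measure_toMeasurable_inter_of_sFinite measurableSet_ball]

lemma HasDensity.compl {n : ℕ} {D : Set (Euc n)} (hD : MeasurableSet D) {x : Euc n} {c : ℝ≥0∞}
    (h : HasDensity D x c) : HasDensity Dᶜ x (1 - c) := by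
  have h1 : Tendsto (fun r : ℝ => 1 - volume (D ∩ ball x r) / volume (ball x r))
      (𝓝[>] 0) (𝓝 (1 - c)) :=
    ENNReal.Tendsto.sub tendsto_const_nhds h (Or.inl ENNReal.one_ne_top)
  refine h1.congr' ?_
  filter_upwards [self_mem_nhdsWithin] with r hr
  have hr : 0 < r := hr
  have hb : volume (ball x r) ≠ 0 := (measure_ball_pos _ _ hr).ne'
  have hbt : volume (ball x r) ≠ ⊤ := measure_ball_lt_top.ne
  have hsum : volume (Dᶜ ∩ ball x r) / volume (ball x r)
      + volume (D ∩ ball x r) / volume (ball x r) = 1 := by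
    rw [← ENNReal.add_div, inter_comm, inter_comm D, add_comm, ← sdiff_eq,
      measure_inter_add_sdiff _ hD, ENNReal.div_self hb hbt]
  refine (ENNReal.eq_sub_of_add_eq ?_ hsum).symm
  exact (ENNReal.div_lt_top ((measure_mono inter_subset_right).trans_lt hbt.lt_top).ne hb).ne

lemma HasDensity.image_one {n : ℕ} (e : Euc n ≃ Euc n) {L M : ℝ≥0} (hM : 0 < M)
    (hL : LipschitzWith L e) (hMe : LipschitzWith M e.symm) {D : Set (Euc n)} {x : Euc n}
    (h : HasDensity D x 1) : HasDensity (e '' D) (e x) 1 := by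
  set D' := toMeasurable volume D with hD'
  have hmD' : MeasurableSet D' := measurableSet_toMeasurable _ _
  have h0 : HasDensity D'ᶜ x 0 := by
    simpa using (hasDensity_toMeasurable.2 h).compl hmD'
  have hmeas : MeasurableSet (e '' D') := by
    rw [e.image_eq_preimage_symm]
    exact hMe.continuous.measurable hmD'
  have h1 : HasDensity (e '' D') (e x) 1 := by
    have := (h0.image_zero e hM hL hMe)
    rw [image_compl_eq e.bijective] at this
    simpa using this.compl hmeas.compl
  set H := toMeasurable volume (e '' D) with hH
  have hmH : MeasurableSet H := measurableSet_toMeasurable _ _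
  have hnull : volume (D' ∩ (e ⁻¹' H)ᶜ) = 0 := by
    rw [hD', Measure.measure_toMeasurable_inter_of_sFinite (hL.continuous.measurable hmH).compl]
    have : D ∩ (e ⁻¹' H)ᶜ = ∅ := by
      ext z
      simp only [mem_inter_iff, mem_compl_iff, mem_preimage, mem_empty_iff_false, iff_false,
        not_and, not_not]
      exact fun hz => subset_toMeasurable _ _ (mem_image_of_mem e hz)
    rw [this, measure_empty]
  have hnull' : volume (e '' (D' ∩ (e ⁻¹' H)ᶜ)) = 0 := by
    have := hL.volume_image_le (D' ∩ (e ⁻¹' H)ᶜ)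
    rw [hnull, mul_zero] at this
    exact le_antisymm this zero_le
  have hle : ∀ s : Set (Euc n), MeasurableSet s →
      volume (e '' D' ∩ s) ≤ volume (e '' D ∩ s) := by
    intro s hs
    rw [← Measure.measure_toMeasurable_inter_of_sFinite hs (e '' D), ← hH]
    have : e '' D' ∩ s ⊆ H ∩ s ∪ e '' (D' ∩ (e ⁻¹' H)ᶜ) := by
      rintro _ ⟨⟨z, hz, rfl⟩, hzs⟩
      by_cases hzH : e z ∈ H
      · exact Or.inl ⟨hzH, hzs⟩
      · exact Or.inr ⟨z, ⟨hz, hzH⟩, rfl⟩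
    calc _ ≤ _ := measure_mono this
      _ ≤ _ := measure_union_le _ _
      _ = _ := by rw [hnull', add_zero]
  refine h1.congr fun r => ?_
  congr 1
  refine le_antisymm (hle _ measurableSet_ball) (measure_mono ?_)
  gcongr
  exact subset_toMeasurable _ _

lemma essBoundary_image_subset {n : ℕ} (e : Euc n ≃ Euc n) {L M : ℝ≥0} (hM : 0 < M)
    (hL : LipschitzWith L e) (hMe : LipschitzWith M e.symm) (D : Set (Euc n)) :
    essBoundary (e '' D) ⊆ e '' essBoundary D := by
  intro y hy
  refine ⟨e.symm y, ?_, e.apply_symm_apply y⟩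
  rw [mem_essBoundary_iff] at hy ⊢
  refine ⟨fun h => hy.1 ?_, fun h => hy.2 ?_⟩
  · simpa using h.image_zero e hM hL hMe
  · simpa using h.image_one e hM hL hMe

lemma perim_image_le {n : ℕ} (hn : 1 ≤ n) (e : Euc n ≃ Euc n) {L M : ℝ≥0} (hM : 0 < M)
    (hL : LipschitzWith L e) (hMe : LipschitzWith M e.symm) (D : Set (Euc n)) :
    perim n (e '' D) ≤ (L : ℝ≥0∞) ^ (n - 1) * perim n D := by
  have hcast : (n : ℝ) - 1 = ((n - 1 : ℕ) : ℝ) := by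
    rw [Nat.cast_sub hn, Nat.cast_one]
  have h := hL.hausdorffMeasure_image_le (d := (n : ℝ) - 1) (by rw [hcast]; positivity)
    (essBoundary D)
  refine (measure_mono (essBoundary_image_subset e hM hL hMe D)).trans ?_
  rw [hcast, ENNReal.rpow_natCast] at h
  rwa [perim, hcast]

lemma volume_le_volume_image {n : ℕ} (e : Euc n ≃ Euc n) {M : ℝ≥0}
    (hMe : LipschitzWith M e.symm) (D : Set (Euc n)) :
    volume D ≤ (M : ℝ≥0∞) ^ n * volume (e '' D) := by
  simpa [image_image] using hMe.volume_image_le (e '' D)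

lemma cheeger_nonneg (n : ℕ) (Ω : Set (Euc n)) : 0 ≤ cheeger n Ω := by
  refine Real.sInf_nonneg ?_
  rintro _ ⟨D, -, -, -, rfl⟩
  positivity

/-- A bi-Lipschitz bijection maps sets of finite perimeter and positive volume to such sets. -/
lemma admissible_image {n : ℕ} (hn : 1 ≤ n) (e : Euc n ≃ Euc n) {L M : ℝ≥0} (hM : 0 < M)
    (hL : LipschitzWith L e) (hMe : LipschitzWith M e.symm) {D : Set (Euc n)}
    (hP : perim n D < ⊤) (hV : 0 < volume D) :
    perim n (e '' D) < ⊤ ∧ 0 < volume (e '' D) := by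
  refine ⟨(perim_image_le hn e hM hL hMe D).trans_lt (by finiteness), ?_⟩
  by_contra h
  have h0 : volume (e '' D) = 0 := by simpa using h
  have := volume_le_volume_image e hMe D
  rw [h0, mul_zero] at this
  exact absurd hV (not_lt.2 this)

lemma cheeger_image_le {n : ℕ} (hn : 1 ≤ n) (e : Euc n ≃ Euc n) {L M : ℝ≥0} (hL0 : 0 < L)
    (hM : 0 < M) (hL : LipschitzWith L e) (hMe : LipschitzWith M e.symm) {Ω : Set (Euc n)}
    (hΩ : IsBounded Ω) :
    cheeger n (e '' Ω) ≤ (L : ℝ) ^ (n - 1) * (M : ℝ) ^ n * cheeger n Ω := by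
  have hL' : (0 : ℝ) < L := hL0
  have hM' : (0 : ℝ) < M := hM
  have hC : 0 < (L : ℝ) ^ (n - 1) * (M : ℝ) ^ n := by positivity
  by_cases hex : ∃ D ⊆ Ω, perim n D < ⊤ ∧ 0 < volume D
  · rw [← div_le_iff₀' hC]
    obtain ⟨D₀, hD₀, hP₀, hV₀⟩ := hex
    refine le_csInf ⟨_, D₀, hD₀, hP₀, hV₀, rfl⟩ ?_
    rintro _ ⟨D, hD, hP, hV, rfl⟩
    obtain ⟨hP', hV'⟩ := admissible_image hn e hM hL hMe hP hV
    rw [div_le_iff₀' hC]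
    have hle : cheeger n (e '' Ω) ≤ (perim n (e '' D)).toReal / (volume (e '' D)).toReal := by
      refine csInf_le ⟨0, ?_⟩ ⟨e '' D, image_mono hD, hP', hV', rfl⟩
      rintro _ ⟨_, -, -, -, rfl⟩
      positivity
    refine hle.trans ?_
    have hVt : volume D ≠ ⊤ := (hΩ.subset hD).measure_lt_top.ne
    have hVt' : volume (e '' D) ≠ ⊤ :=
      ((hL.volume_image_le D).trans_lt (by finiteness)).ne
    have h1 : (perim n (e '' D)).toReal ≤ (L : ℝ) ^ (n - 1) * (perim n D).toReal := by
      have := ENNReal.toReal_mono (by finiteness) (perim_image_le hn e hM hL hMe D)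
      simpa using this
    have h2 : (volume D).toReal ≤ (M : ℝ) ^ n * (volume (e '' D)).toReal := by
      have := ENNReal.toReal_mono (by finiteness) (volume_le_volume_image e hMe D)
      simpa using this
    have hv : 0 < (volume D).toReal := ENNReal.toReal_pos hV.ne' hVt
    have hv' : 0 < (volume (e '' D)).toReal := ENNReal.toReal_pos hV'.ne' hVt'
    rw [← mul_div_assoc, div_le_div_iff₀ hv' hv]
    calc _ ≤ ((L : ℝ) ^ (n - 1) * (perim n D).toReal) *
          ((M : ℝ) ^ n * (volume (e '' D)).toReal) := by gcongr
      _ = _ := by ring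
  · have hempty : {r : ℝ | ∃ D : Set (Euc n), D ⊆ e '' Ω ∧ perim n D < ⊤ ∧ 0 < volume D ∧
        r = (perim n D).toReal / (volume D).toReal} = ∅ := by
      refine eq_empty_of_forall_notMem ?_
      rintro _ ⟨D, hD, hP, hV, -⟩
      refine hex ⟨e.symm '' D, ?_, admissible_image hn e.symm hL0 hMe (by simpa using hL) hP hV⟩
      rwa [e.symm_image_subset]
    rw [cheeger, hempty, Real.sInf_empty]
    exact mul_nonneg hC.le (cheeger_nonneg n Ω)

/-- A small Lipschitz perturbation of a dilation is a bi-Lipschitz bijection. -/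
lemma exists_equiv_smul_add {n : ℕ} {a : ℝ} {k : ℝ≥0} (hk : (k : ℝ) < a)
    {f : Euc n → Euc n} (hf : LipschitzWith k f) :
    ∃ e : Euc n ≃ Euc n, (⇑e = fun x => a • x + f x) ∧
      LipschitzWith (Real.toNNReal (a + k)) e ∧
      LipschitzWith (Real.toNNReal (a - k)⁻¹) e.symm := by
  have ha : 0 < a := k.2.trans_lt hk
  have hak : 0 < a - k := sub_pos.2 hk
  set T : Euc n → Euc n := fun x => a • x + f x with hT
  have hfd : ∀ x y, ‖f x - f y‖ ≤ k * ‖x - y‖ := fun x y => by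
    simpa [dist_eq_norm] using hf.dist_le_mul x y
  have hlow : ∀ x y, (a - k) * ‖x - y‖ ≤ ‖T x - T y‖ := fun x y => by
    have h1 : a • (x - y) = (T x - T y) - (f x - f y) := by
      simp only [hT, smul_sub]; abel
    have h2 := norm_sub_le (T x - T y) (f x - f y)
    rw [← h1, norm_smul, Real.norm_of_nonneg ha.le] at h2
    linarith [hfd x y]
  have hinj : Function.Injective T := fun x y hxy => by
    have := hlow x y
    rw [hxy, sub_self, norm_zero] at this
    have h0 : ‖x - y‖ ≤ 0 := by
      by_contra h
      push Not at h
      exact absurd this (not_le.2 (mul_pos hak h))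
    exact sub_eq_zero.1 (norm_le_zero_iff.1 h0)
  have hsurj : Function.Surjective T := fun y => by
    have hcon : ContractingWith (Real.toNNReal (k / a)) (fun x => a⁻¹ • (y - f x)) := by
      refine ⟨Real.toNNReal_lt_one.2 ((div_lt_one ha).2 hk),
        LipschitzWith.of_dist_le_mul fun u v => ?_⟩
      rw [Real.coe_toNNReal _ (by positivity)]
      have : a⁻¹ • (y - f u) - a⁻¹ • (y - f v) = a⁻¹ • (f v - f u) := by
        rw [← smul_sub]; congr 1; abel
      rw [dist_eq_norm, this, norm_smul, Real.norm_of_nonneg (inv_nonneg.2 ha.le),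
        norm_sub_rev, dist_eq_norm]
      calc a⁻¹ * ‖f u - f v‖ ≤ a⁻¹ * (k * ‖u - v‖) := by gcongr; exact hfd u v
        _ = k / a * ‖u - v‖ := by ring
    refine ⟨hcon.fixedPoint, ?_⟩
    have hx := hcon.fixedPoint_isFixedPt
    set x := hcon.fixedPoint
    have hx : a⁻¹ • (y - f x) = x := hx
    have : a • x = y - f x := by
      rw [← hx, smul_smul, mul_inv_cancel₀ ha.ne', one_smul, hx]
    simp only [hT, this, sub_add_cancel]
  have hbij : Function.Bijective T := ⟨hinj, hsurj⟩
  refine ⟨Equiv.ofBijective T hbij, rfl, LipschitzWith.of_dist_le_mul fun x y => ?_,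
    LipschitzWith.of_dist_le_mul fun x y => ?_⟩
  · rw [Real.coe_toNNReal _ (by positivity), dist_eq_norm, dist_eq_norm, Equiv.ofBijective_apply,
      Equiv.ofBijective_apply]
    have : T x - T y = a • (x - y) + (f x - f y) := by
      simp only [hT, smul_sub]; abel
    rw [this]
    refine (norm_add_le _ _).trans ?_
    rw [norm_smul, Real.norm_of_nonneg ha.le]
    linarith [hfd x y]
  · obtain ⟨u, rfl⟩ := hsurj x
    obtain ⟨v, rfl⟩ := hsurj y
    rw [Real.coe_toNNReal _ (by positivity), Equiv.ofBijective_symm_apply_apply,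
      Equiv.ofBijective_symm_apply_apply, dist_eq_norm, dist_eq_norm, inv_mul_eq_div,
      le_div_iff₀' hak]
    exact hlow u v

lemma cheeger_smul_add_bounds {n : ℕ} (hn : 1 ≤ n) {a : ℝ} {k : ℝ≥0} (hk : (k : ℝ) < a)
    {f : Euc n → Euc n} (hf : LipschitzWith k f) {Ω : Set (Euc n)} (hΩ : IsBounded Ω) :
    cheeger n ((fun x => a • x + f x) '' Ω) ≤ (a + k) ^ (n - 1) / (a - k) ^ n * cheeger n Ω ∧
    (a - k) ^ (n - 1) / (a + k) ^ n * cheeger n Ω ≤ cheeger n ((fun x => a • x + f x) '' Ω) := by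
  have ha : 0 < a := k.2.trans_lt hk
  have hak : 0 < a - k := sub_pos.2 hk
  have hak' : 0 < a + k := by positivity
  obtain ⟨e, he, hL, hM⟩ := exists_equiv_smul_add hk hf
  have hL0 : 0 < Real.toNNReal (a + k) := Real.toNNReal_pos.2 hak'
  have hM0 : 0 < Real.toNNReal (a - k)⁻¹ := Real.toNNReal_pos.2 (inv_pos.2 hak)
  rw [← he]
  constructor
  · have := cheeger_image_le hn e hL0 hM0 hL hM hΩ
    rwa [Real.coe_toNNReal _ hak'.le, Real.coe_toNNReal _ (inv_pos.2 hak).le, inv_pow,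
      ← div_eq_mul_inv] at this
  · have := cheeger_image_le hn e.symm hM0 hL0 hM (by simpa using hL)
      (hL.isBounded_image hΩ)
    rw [Real.coe_toNNReal _ hak'.le, Real.coe_toNNReal _ (inv_pos.2 hak).le, inv_pow,
      image_image] at this
    simp only [Equiv.symm_apply_apply, image_id'] at this
    rw [div_mul_eq_mul_div, div_le_iff₀' (by positivity)]
    rwa [mul_assoc, inv_mul_eq_div, le_div_iff₀' (by positivity)] at this

lemma hasDerivAt_dilation_ratio {n : ℕ} (hn : 1 ≤ n) (Λ ε : ℝ) :
    HasDerivAt (fun t : ℝ => (1 - t * Λ + ε * t) ^ (n - 1) / (1 - t * Λ - ε * t) ^ n)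
      (Λ + (2 * n - 1) * ε) 0 := by
  have h1 : HasDerivAt (fun t : ℝ => 1 - t * Λ + ε * t) (-Λ + ε) 0 := by
    simpa using (((hasDerivAt_id' (0 : ℝ)).mul_const Λ).const_sub 1).fun_add
      ((hasDerivAt_id' (0 : ℝ)).const_mul ε)
  have h2 : HasDerivAt (fun t : ℝ => 1 - t * Λ - ε * t) (-Λ - ε) 0 := by
    simpa using (((hasDerivAt_id' (0 : ℝ)).mul_const Λ).const_sub 1).fun_sub
      ((hasDerivAt_id' (0 : ℝ)).const_mul ε)
  have h := (h1.fun_pow (n - 1)).fun_div (h2.fun_pow n) (by simp)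
  refine h.congr_deriv ?_
  simp [Nat.cast_sub hn]
  ring

/-- for regular perturbations `Ω_δ = T_δ(Ω)` with
`T_δ(x) = (1 − δΛ)x + R(x,δ)`, the Cheeger constant is continuous and
differentiable at `δ = 0` with derivative `Λ h(Ω)`. -/
theorem cheeger_diffeo_perturbation (n : ℕ) (hn : 2 ≤ n) (Ω : Set (Euc n))
    (hΩo : IsOpen Ω) (hΩb : IsBounded Ω) (hΩne : Ω.Nonempty) (Λ : ℝ)
    (R : ℝ → Euc n → Euc n)
    (hRc : ∀ δ, ContDiff ℝ 1 (R δ))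
    (hdiffeo : ∀ δ, Function.Injective (fun x => (1 - δ * Λ) • x + R δ x))
    (hRo : ∀ ε > (0 : ℝ), ∀ᶠ δ in 𝓝 (0 : ℝ), ∀ x, ‖R δ x‖ ≤ ε * |δ|)
    (hDRo : ∀ ε > (0 : ℝ), ∀ᶠ δ in 𝓝 (0 : ℝ), ∀ x, ‖fderiv ℝ (R δ) x‖ ≤ ε * |δ|)
    (hR0 : ∀ x, R 0 x = 0) :
    Tendsto
      (fun δ : ℝ => cheeger n ((fun x => (1 - δ * Λ) • x + R δ x) '' Ω))
      (𝓝 0) (𝓝 (cheeger n Ω)) ∧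
    HasDerivAt
      (fun δ : ℝ => cheeger n ((fun x => (1 - δ * Λ) • x + R δ x) '' Ω))
      (Λ * cheeger n Ω) 0 := by
  set h := cheeger n Ω with hh
  set F : ℝ → ℝ := fun δ => cheeger n ((fun x => (1 - δ * Λ) • x + R δ x) '' Ω) with hF
  have hn1 : 1 ≤ n := by omega
  have hh0 : 0 ≤ h := cheeger_nonneg n Ω
  have hF0 : F 0 = h := by simp [hF, hR0, hh]
  have hbounds : ∀ ε > (0 : ℝ), ∀ᶠ δ in 𝓝 (0 : ℝ),
      F δ ≤ (1 - δ * Λ + ε * |δ|) ^ (n - 1) / (1 - δ * Λ - ε * |δ|) ^ n * h ∧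
      (1 - δ * Λ - ε * |δ|) ^ (n - 1) / (1 - δ * Λ + ε * |δ|) ^ n * h ≤ F δ := by
    intro ε hε
    have hpos : ∀ᶠ δ in 𝓝 (0 : ℝ), 0 < 1 - δ * Λ - ε * |δ| := by
      have hc : ContinuousAt (fun δ : ℝ => 1 - δ * Λ - ε * |δ|) 0 := by fun_prop
      exact hc.eventually_const_lt (by simp)
    filter_upwards [hpos, hDRo ε hε] with δ hδ hD
    have hk : 0 ≤ ε * |δ| := by positivity
    have hLip : LipschitzWith ⟨ε * |δ|, hk⟩ (R δ) :=
      lipschitzWith_of_nnnorm_fderiv_le ((hRc δ).differentiable (by simp)) fun x => hD x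
    exact cheeger_smul_add_bounds (a := 1 - δ * Λ) (k := ⟨ε * |δ|, hk⟩) hn1
      (sub_pos.1 hδ) hLip hΩb
  have hderiv : HasDerivAt F (Λ * h) 0 := by
    rw [hasDerivAt_iff_isLittleO, isLittleO_iff]
    intro c hc
    set ε : ℝ := c / (2 * n * (h + 1)) with hεdef
    have hnpos : (0 : ℝ) < n := by exact_mod_cast hn1
    have hε : 0 < ε := by positivity
    have hεc : 2 * n * ε * h ≤ c := by
      have : 2 * n * ε * (h + 1) = c := by rw [hεdef]; field_simp
      nlinarith [mul_pos hnpos hε]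
    have key : ∀ η : ℝ, |η| = ε → ∀ᶠ δ in 𝓝 (0 : ℝ),
        |(1 - δ * Λ + η * δ) ^ (n - 1) / (1 - δ * Λ - η * δ) ^ n * h - h - δ * (Λ * h)|
          ≤ c * |δ| := by
      intro η hη
      have hg := isLittleO_iff.1 (hasDerivAt_iff_isLittleO.1 (hasDerivAt_dilation_ratio hn1 Λ η)) hε
      filter_upwards [hg] with δ hδ
      simp only [zero_mul, mul_zero, sub_zero, add_zero, one_pow, div_one, smul_eq_mul,
        Real.norm_eq_abs] at hδ
      set g := (1 - δ * Λ + η * δ) ^ (n - 1) / (1 - δ * Λ - η * δ) ^ n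
      have e1 : g * h - h - δ * (Λ * h) =
          ((g - 1 - δ * (Λ + (2 * n - 1) * η)) + (2 * n - 1) * (η * δ)) * h := by ring
      have hn2 : (0 : ℝ) ≤ 2 * n - 1 := by
        have : (1 : ℝ) ≤ n := by exact_mod_cast hn1
        linarith
      rw [e1, abs_mul, abs_of_nonneg hh0]
      calc _ ≤ (ε * |δ| + (2 * n - 1) * (ε * |δ|)) * h := by
            gcongr
            refine (abs_add_le _ _).trans ?_
            rw [abs_mul (2 * (n : ℝ) - 1), abs_of_nonneg hn2, abs_mul η, hη]
            gcongr
        _ = 2 * n * ε * h * |δ| := by ring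
        _ ≤ c * |δ| := by gcongr
    filter_upwards [hbounds ε hε, key ε (abs_of_pos hε), key (-ε) (by simp [abs_of_pos hε])]
      with δ ⟨hu, hl⟩ kp km
    rw [hF0, sub_zero, smul_eq_mul, Real.norm_eq_abs, Real.norm_eq_abs]
    rw [abs_le] at kp km ⊢
    rcases le_total 0 δ with hδ | hδ
    · rw [abs_of_nonneg hδ] at *
      simp only [neg_mul, sub_neg_eq_add, ← sub_eq_add_neg] at km
      constructor <;> linarith [kp.1, kp.2, km.1, km.2]
    · rw [abs_of_nonpos hδ] at *
      simp only [neg_mul, mul_neg, sub_neg_eq_add, ← sub_eq_add_neg] at km hu hl kp ⊢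
      constructor <;> linarith [kp.1, kp.2, km.1, km.2]
  refine ⟨?_, hderiv⟩
  have := hderiv.continuousAt.tendsto
  rwa [hF0] at this

end
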